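/- In the abelian group G = ℤ/17 × ℤ/17 (of order 289), the four 9-element subsets B₁ = {(0,0),(0,1),(0,3),(1,3),(2,2),(3,3),(4,10),(6,16),(10,14)}, B₂ = {(0,0),(0,4),(0,9),(1,15),(5,9),(9,13),(10,8),(11,16),(13,9)}, B₃ = {(0,0),(0,6),(2,15),(3,11),(5,8),(10,9),(11,14),(13,1),(14,11)}, B₄ = {(0,0),(0,7),(5,14),(7,2),(9,15),(11,5),(12,14),(14,9),(16,3)} form a (289,9,1)-difference family: every nonzero element g of G has exactly one representation g = x − y with x, y belonging to the same block Bᵢ. -/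

import Mathlib

def B10 : Fin 4 → Finset (ZMod 17 × ZMod 17) :=
  ![({(0, 0), (0, 1), (0, 3), (1, 3), (2, 2), (3, 3), (4, 10), (6, 16), (10, 14)} : Finset (ZMod 17 × ZMod 17)),
    ({(0, 0), (0, 4), (0, 9), (1, 15), (5, 9), (9, 13), (10, 8), (11, 16), (13, 9)} : Finset (ZMod 17 × ZMod 17)),
    ({(0, 0), (0, 6), (2, 15), (3, 11), (5, 8), (10, 9), (11, 14), (13, 1), (14, 11)} : Finset (ZMod 17 × ZMod 17)),
    ({(0, 0), (0, 7), (5, 14), (7, 2), (9, 15), (11, 5), (12, 14), (14, 9), (16, 3)} : Finset (ZMod 17 × ZMod 17))]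

theorem B10_card (i : Fin 4) : (B10 i).card = 9 := by
  revert i; decide +kernel

/-- The position of `g` in the lexicographic enumeration of `ZMod 17 × ZMod 17`. -/
def lexIndex (g : ZMod 17 × ZMod 17) : ℕ :=
  17 * g.1.val + g.2.val

theorem lexIndex_lt (g : ZMod 17 × ZMod 17) : lexIndex g < 289 := by
  have h₁ := ZMod.val_lt g.1
  have h₂ := ZMod.val_lt g.2
  simp only [lexIndex]
  omega

theorem lexIndex_injective : Function.Injective lexIndex := by
  intro g h hgh
  have h₁ := ZMod.val_lt g.2
  have h₂ := ZMod.val_lt h.2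
  simp only [lexIndex] at hgh
  exact Prod.ext (ZMod.val_injective 17 (by omega)) (ZMod.val_injective 17 (by omega))

instance Nat.commutative_lor : Std.Commutative Nat.lor :=
  ⟨Nat.lor_comm⟩

instance Nat.associative_lor : Std.Associative Nat.lor :=
  ⟨Nat.lor_assoc⟩

theorem Finset.testBit_fold_lor {α : Type*} (s : Finset α) (f : α → ℕ) (k : ℕ) :
    (s.fold Nat.lor 0 f).testBit k = true ↔ ∃ a ∈ s, (f a).testBit k = true := by
  classical
  induction s using Finset.induction_on with
  | empty => simp
  | insert a s ha ih =>
    rw [Finset.fold_insert ha]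
    change (f a ||| s.fold Nat.lor 0 f).testBit k = true ↔ _
    simp [ih]

theorem B10_fold_lor_sub :
    (Finset.univ.fold Nat.lor 0 fun i =>
      (B10 i).fold Nat.lor 0 fun x =>
        (B10 i).fold Nat.lor 0 fun y => 2 ^ lexIndex (x - y)) = 2 ^ 289 - 1 := by
  decide +kernel

theorem B10_exists_sub_eq (g : ZMod 17 × ZMod 17) :
    ∃ i, ∃ x ∈ B10 i, ∃ y ∈ B10 i, x - y = g := by
  have h : (2 ^ 289 - 1).testBit (lexIndex g) = true := by
    simp only [Nat.testBit_two_pow_sub_one, lexIndex_lt, decide_true]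
  rw [← B10_fold_lor_sub] at h
  simp only [Finset.testBit_fold_lor, Nat.testBit_two_pow, decide_eq_true_eq] at h
  obtain ⟨i, -, x, hx, y, hy, hxy⟩ := h
  exact ⟨i, x, hx, y, hy, lexIndex_injective hxy⟩

/-- The ordered pairs of distinct elements lying in a common block. -/
def B10Pairs : Finset (Σ _ : Fin 4, (ZMod 17 × ZMod 17) × (ZMod 17 × ZMod 17)) :=
  Finset.univ.sigma fun i => (B10 i).offDiag

theorem B10Pairs_card : B10Pairs.card = 288 := by
  simp [B10Pairs, Finset.card_sigma, Finset.offDiag_card, B10_card]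

theorem B10Pairs_image_sub :
    B10Pairs.image (fun t => t.2.1 - t.2.2) = Finset.univ.erase 0 := by
  ext g
  simp only [Finset.mem_image, Finset.mem_erase, Finset.mem_univ, and_true]
  constructor
  · rintro ⟨⟨i, x, y⟩, h, rfl⟩
    simp only [B10Pairs, Finset.mem_sigma, Finset.mem_offDiag] at h
    exact sub_ne_zero.2 h.2.2.2
  · intro hg
    obtain ⟨i, x, hx, y, hy, rfl⟩ := B10_exists_sub_eq g
    exact ⟨⟨i, x, y⟩, by simp [B10Pairs, hx, hy, sub_ne_zero.1 hg], rfl⟩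

theorem B10Pairs_injOn_sub :
    Set.InjOn (fun t : Σ _ : Fin 4, (ZMod 17 × ZMod 17) × (ZMod 17 × ZMod 17) => t.2.1 - t.2.2)
      B10Pairs := by
  rw [← Finset.card_image_iff, B10Pairs_image_sub, B10Pairs_card,
    Finset.card_erase_of_mem (Finset.mem_univ _), Finset.card_univ, Fintype.card_prod, ZMod.card]

theorem stmt_10 :
    (∀ i : Fin 4, (B10 i).card = 9) ∧
    ∀ g : ZMod 17 × ZMod 17, g ≠ 0 →
      ∃! t : Fin 4 × (ZMod 17 × ZMod 17) × (ZMod 17 × ZMod 17),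
        t.2.1 ∈ B10 t.1 ∧ t.2.2 ∈ B10 t.1 ∧ t.2.1 - t.2.2 = g := by
  refine ⟨B10_card, fun g hg => ?_⟩
  obtain ⟨i, x, hx, y, hy, hxy⟩ := B10_exists_sub_eq g
  refine ⟨(i, x, y), ⟨hx, hy, hxy⟩, ?_⟩
  rintro ⟨j, u, v⟩ ⟨hu, hv, huv⟩
  dsimp only at hu hv huv
  have mem_pairs : ∀ {k a b}, a ∈ B10 k → b ∈ B10 k → a - b = g →
      (⟨k, a, b⟩ : Σ _ : Fin 4, (ZMod 17 × ZMod 17) × (ZMod 17 × ZMod 17)) ∈ B10Pairs := by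
    intro k a b ha hb hab
    simp only [B10Pairs, Finset.mem_sigma, Finset.mem_univ, Finset.mem_offDiag, true_and]
    exact ⟨ha, hb, sub_ne_zero.1 (hab ▸ hg)⟩
  have h := B10Pairs_injOn_sub (mem_pairs hu hv huv) (mem_pairs hx hy hxy) (huv.trans hxy.symm)
  cases h
  rfl
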